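/- Let H be an elementary abelian 2-hypergroup and G a closed subset of H. Then G is a residually thin closed subset of H if and only if G = O_ϑ(G). In particular, H is a residually thin hypergroup if and only if H = O_ϑ(H). -/

import Mathlib

namespace HyperPaper

/-- A hypergroup: hypermultiplication `hmul`, inversion `star`, identity `e`,
satisfying (H1) associativity, (H2) unique two-sided identity, (H3) exchange conditions. -/
structure Hypergroup (H : Type*) where
  hmul : H → H → Set H
  star : H → H
  e : H
  idl : ∀ p, hmul e p = {p}
  idr : ∀ p, hmul p e = {p}
  e_unique : ∀ e' : H, (∀ p, hmul e' p = {p} ∧ hmul p e' = {p}) → e' = e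
  assoc : ∀ p q r : H, (⋃ x ∈ hmul p q, hmul x r) = ⋃ x ∈ hmul q r, hmul p x
  h3l : ∀ p q r : H, p ∈ hmul q r ↔ q ∈ hmul p (star r)
  h3r : ∀ p q r : H, p ∈ hmul q r ↔ r ∈ hmul (star q) p

variable {H : Type*}

namespace Hypergroup

/-- Product of two subsets: FG = {a : ∃ b ∈ F, c ∈ G, a ∈ bc}. -/
def smul (hg : Hypergroup H) (F G : Set H) : Set H :=
  {a | ∃ b ∈ F, ∃ c ∈ G, a ∈ hg.hmul b c}

/-- Closed subset: nonempty and G*G ⊆ G. -/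
def IsClosed (hg : Hypergroup H) (G : Set H) : Prop :=
  G.Nonempty ∧ hg.smul (hg.star '' G) G ⊆ G

/-- Thin element: p*p = {e}. -/
def IsThin (hg : Hypergroup H) (p : H) : Prop := hg.hmul (hg.star p) p = {hg.e}

/-- Thick element: not thin. -/
def IsThick (hg : Hypergroup H) (p : H) : Prop := ¬ hg.IsThin p

/-- Involution: p ≠ e and {e, p} is closed. -/
def IsInvolution (hg : Hypergroup H) (p : H) : Prop :=
  p ≠ hg.e ∧ hg.IsClosed {hg.e, p}

/-- ⟨G⟩: smallest closed subset containing G. -/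
def gen (hg : Hypergroup H) (G : Set H) : Set H := ⋂₀ {C | hg.IsClosed C ∧ G ⊆ C}

/-- O_ϑ(G): the thin elements of H lying in G. -/
def Othin (hg : Hypergroup H) (G : Set H) : Set H := {p ∈ G | hg.IsThin p}

/-- F is a strongly normal closed subset of G: p*Fp ⊆ F ⊆ G for all p ∈ G. -/
def IsStronglyNormal (hg : Hypergroup H) (F G : Set H) : Prop :=
  hg.IsClosed F ∧ hg.IsClosed G ∧ F ⊆ G ∧
    ∀ p ∈ G, hg.smul (hg.smul {hg.star p} F) {p} ⊆ F

/-- O^ϑ(G): intersection of all strongly normal closed subsets of ⟨G⟩. -/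
def Osup (hg : Hypergroup H) (G : Set H) : Set H :=
  ⋂₀ {F | hg.IsStronglyNormal F (hg.gen G)}

/-- F is a normal closed subset of G. -/
def IsNormal (hg : Hypergroup H) (F G : Set H) : Prop :=
  hg.IsClosed F ∧ hg.IsClosed G ∧ F ⊆ G ∧ ∀ p ∈ G, hg.smul F {p} = hg.smul {p} F

/-- Product of a list of subsets (empty product is {e}). -/
def listProd (hg : Hypergroup H) : List (Set H) → Set H
  | [] => {hg.e}
  | a :: l => hg.smul a (hg.listProd l)

/-- Product r_1 r_2 ⋯ r_n of a family of elements. -/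
def famProd (hg : Hypergroup H) {n : ℕ} (r : Fin n → H) : Set H :=
  hg.listProd ((List.finRange n).map fun i => ({r i} : Set H))

/-- Ĝ_i: the product of the G_j with j ≠ i. -/
def cofactor (hg : Hypergroup H) {n : ℕ} (G : Fin n → Set H) (i : Fin n) : Set H :=
  hg.listProd (((List.finRange n).filter fun j => decide (j ≠ i)).map G)

/-- H is the direct product of the normal closed subsets G_1, …, G_n. -/
def IsDirectProduct (hg : Hypergroup H) {n : ℕ} (G : Fin n → Set H) : Prop :=
  (∀ i, hg.IsNormal (G i) Set.univ) ∧
  (∀ i, hg.smul (G i) (hg.cofactor G i) = Set.univ) ∧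
  (∀ i, G i ∩ hg.cofactor G i = {hg.e})

/-- r : Fin n → H is a decomposition of x with respect to the family G. -/
def IsDecomp (hg : Hypergroup H) {n : ℕ} (G : Fin n → Set H) (x : H) (r : Fin n → H) : Prop :=
  (∀ i, r i ∈ G i) ∧ x ∈ hg.famProd r

/-- The support of x: the elements ≠ e appearing in the decomposition of x. -/
def dsupport (hg : Hypergroup H) {n : ℕ} (G : Fin n → Set H) (x : H) : Set H :=
  {y | y ≠ hg.e ∧ ∃ r, hg.IsDecomp G x r ∧ y ∈ Set.range r}

/-- The cover of x: the product r_1r_2⋯r_n for the decomposition of x. -/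
def dcover (hg : Hypergroup H) {n : ℕ} (G : Fin n → Set H) (x : H) : Set H :=
  {y | ∃ r, hg.IsDecomp G x r ∧ y ∈ hg.famProd r}

/-- x is constrained: its cover equals {x}. -/
def IsConstrained (hg : Hypergroup H) {n : ℕ} (G : Fin n → Set H) (x : H) : Prop :=
  hg.dcover G x = {x}

/-- r_2(G): the largest 2-rank of a thin closed subset of H contained in G
(equivalently, the largest k such that G contains a thin symmetric closed subset
of 2^k elements, which corresponds to an elementary abelian 2-group of 2-rank k). -/
noncomputable def rank2 (hg : Hypergroup H) (G : Set H) : ℕ :=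
  sSup {k | ∃ U : Set H, hg.IsClosed U ∧ U ⊆ G ∧ (∀ u ∈ U, hg.IsThin u) ∧
    (∀ u ∈ U, hg.star u = u) ∧ U.ncard = 2 ^ k}

/-- F is a minimal generating subset of G. -/
def IsMinGen (hg : Hypergroup H) (G F : Set H) : Prop :=
  F ⊆ G ∧ hg.gen F = G ∧ ∀ p ∈ F, hg.gen (F \ {p}) ≠ G

/-- The dimension of G: the smallest cardinality of a minimal generating subset. -/
noncomputable def dimension (hg : Hypergroup H) (G : Set H) : ℕ :=
  sInf {k | ∃ F : Set H, hg.IsMinGen G F ∧ F.Finite ∧ F.ncard = k}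

/-- [F, G] = ⟨{a : ∃ b ∈ F, c ∈ G, a ∈ b*c*bc}⟩. -/
def commSet (hg : Hypergroup H) (F G : Set H) : Set H :=
  hg.gen {a | ∃ b ∈ F, ∃ c ∈ G,
    a ∈ hg.smul (hg.smul (hg.smul {hg.star b} {hg.star c}) {b}) {c}}

/-- derived G k = G^{(k+1)}: G^{(1)} = G, G^{(r)} = [G^{(r-1)}, G]. -/
def derived (hg : Hypergroup H) (G : Set H) : ℕ → Set H
  | 0 => G
  | k + 1 => hg.commSet (hg.derived G k) G

/-- G is nilpotent: G^{(r)} = {e} for some r. -/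
def IsNilpotent (hg : Hypergroup H) (G : Set H) : Prop :=
  ∃ k : ℕ, hg.derived G k = {hg.e}

/-- G is a residually thin closed subset: there is a chain {e} = F_1, …, F_n = G of
pairwise distinct closed subsets, each strongly normal in the next. -/
def IsResiduallyThin (hg : Hypergroup H) (G : Set H) : Prop :=
  ∃ (m : ℕ) (F : Fin (m + 1) → Set H), Function.Injective F ∧
    F 0 = {hg.e} ∧ F (Fin.last m) = G ∧
    ∀ i : Fin m, hg.IsStronglyNormal (F i.castSucc) (F i.succ)

/-- x^k as a subset: x^0 = {e}, x^{k+1} = x^k · x. -/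
def spow (hg : Hypergroup H) (x : H) : ℕ → Set H
  | 0 => {hg.e}
  | k + 1 => hg.smul (hg.spow x k) {x}

/-- F is a maximal closed subset of G. -/
def IsMaximalClosed (hg : Hypergroup H) (F G : Set H) : Prop :=
  hg.IsClosed F ∧ hg.IsClosed G ∧ F ⊆ G ∧ F ≠ G ∧
    ∀ E : Set H, hg.IsClosed E → F ⊆ E → E ⊆ G → E = F ∨ E = G

/-- The Frattini closed subset of G: the intersection (inside G) of all maximal
closed subsets of G. -/
def frattini (hg : Hypergroup H) (G : Set H) : Set H :=
  G ∩ ⋂₀ {F | hg.IsMaximalClosed F G}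

/-- α is an isomorphism from the closed subset F to the closed subset G. -/
def IsIso (hg : Hypergroup H) (F G : Set H) (α : H → H) : Prop :=
  Set.BijOn α F G ∧ α hg.e = hg.e ∧
    ∀ p ∈ F, ∀ q ∈ F, α '' hg.hmul p q = hg.hmul (α p) (α q)

/-- F ≃ G: there is an isomorphism from F to G. -/
def Isomorphic (hg : Hypergroup H) (F G : Set H) : Prop := ∃ α : H → H, hg.IsIso F G α

/-- Aut(G): the automorphism group of G, realized as the subgroup of permutations of G
that fix e and preserve the hypermultiplication. -/
def autGroup (hg : Hypergroup H) (G : Set H) : Subgroup (Equiv.Perm G) where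
  carrier := {σ | (∀ x : G, (x : H) = hg.e → ((σ x : H)) = hg.e) ∧
    ∀ p q x : G, (x : H) ∈ hg.hmul p q ↔ ((σ x : H)) ∈ hg.hmul (σ p) (σ q)}
  one_mem' := by
    constructor
    · intro x hx; simpa using hx
    · intro p q x; simp
  mul_mem' := by
    rintro σ τ ⟨he1, hm1⟩ ⟨he2, hm2⟩
    refine ⟨fun x hx => ?_, fun p q x => ?_⟩
    · simpa using he1 _ (he2 x hx)
    · simpa using (hm2 p q x).trans (hm1 (τ p) (τ q) (τ x))
  inv_mem' := by
    rintro σ ⟨he, hm⟩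
    refine ⟨fun x hx => ?_, fun p q x => ?_⟩
    · have h2 : σ x = x := Subtype.ext ((he x hx).trans hx.symm)
      have h3 : σ⁻¹ x = x := by
        conv_lhs => rw [← h2]
        simp
      rw [h3]; exact hx
    · have h := hm (σ⁻¹ p) (σ⁻¹ q) (σ⁻¹ x)
      simpa using h.symm

end Hypergroup

/-- An elementary abelian 2-hypergroup: a hypergroup that is the constrained direct
product of the closed subsets ⟨q_1⟩, …, ⟨q_n⟩ generated by involutions q_1, …, q_n. -/
structure EA2Data (H : Type*) where
  hg : Hypergroup H
  n : ℕ
  q : Fin n → H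
  invol : ∀ i, hg.IsInvolution (q i)
  dp : hg.IsDirectProduct fun i => hg.gen {q i}
  constrained : ∀ x : H, hg.IsConstrained (fun i => hg.gen {q i}) x

namespace EA2Data

/-- The family ⟨q_1⟩, …, ⟨q_n⟩. -/
def fam (E : EA2Data H) : Fin E.n → Set H := fun i => E.hg.gen {E.q i}

/-- The support of x. -/
def support (E : EA2Data H) (x : H) : Set H := E.hg.dsupport E.fam x

/-- Thick(F): externally thick elements of H lying in F. -/
def ThickIn (E : EA2Data H) (F : Set H) : Set H :=
  {x ∈ F | x = E.hg.e ∨ ∀ y ∈ E.support x, E.hg.IsThick y}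

/-- Thin(F): externally thin elements of H lying in F. -/
def ThinIn (E : EA2Data H) (F : Set H) : Set H :=
  {x ∈ F | x = E.hg.e ∨ ∀ y ∈ E.support x, E.hg.IsThin y}

/-- The (unique) pair (x⁺, x⁻) with x⁺ ∈ Thick(H), x⁻ ∈ Thin(H), x⁺x⁻ = {x}. -/
noncomputable def pm (E : EA2Data H) (x : H) : H × H :=
  @Classical.epsilon (H × H) ⟨(E.hg.e, E.hg.e)⟩ fun z =>
    z.1 ∈ E.ThickIn Set.univ ∧ z.2 ∈ E.ThinIn Set.univ ∧ E.hg.hmul z.1 z.2 = {x}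

/-- x⁺. -/
noncomputable def plus (E : EA2Data H) (x : H) : H := (E.pm x).1

/-- x⁻. -/
noncomputable def minus (E : EA2Data H) (x : H) : H := (E.pm x).2

/-- s(x): the number of thick elements of H in the support of x. -/
noncomputable def sElem (E : EA2Data H) (x : H) : ℕ :=
  {y ∈ E.support x | E.hg.IsThick y}.ncard

/-- s(G) = max {s(a) : a ∈ G}. -/
noncomputable def sSet (E : EA2Data H) (G : Set H) : ℕ :=
  sSup {k | ∃ a ∈ G, E.sElem a = k}

/-- x ⪯ y: the support of x is contained in the support of y. -/
def ple (E : EA2Data H) (x y : H) : Prop := E.support x ⊆ E.support y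

/-- p♯: the number of thick elements among q_1, …, q_n. -/
noncomputable def psharp (E : EA2Data H) : ℕ := {i : Fin E.n | E.hg.IsThick (E.q i)}.ncard

end EA2Data

/-- The Gaussian binomial coefficient C(n, k)_2 with base 2, via the
q-Pascal recurrence C(n, k)_2 = C(n-1, k-1)_2 + 2^k · C(n-1, k)_2. -/
def gaussBinom2 : ℕ → ℕ → ℕ
  | _, 0 => 1
  | 0, _ + 1 => 0
  | n + 1, k + 1 => gaussBinom2 n k + 2 ^ (k + 1) * gaussBinom2 n (k + 1)

end HyperPaper

open HyperPaper

namespace HyperPaper.Hypergroup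

variable {H : Type*}

/-- The complex product makes the subsets of a hypergroup into a monoid. -/
abbrev setMonoid (hg : Hypergroup H) : Monoid (Set H) where
  mul := hg.smul
  one := {hg.e}
  mul_assoc A B C := by
    change hg.smul (hg.smul A B) C = hg.smul A (hg.smul B C)
    ext a
    constructor
    · rintro ⟨x, ⟨b, hb, c, hc, hx⟩, d, hd, ha⟩
      have h : a ∈ ⋃ x ∈ hg.hmul b c, hg.hmul x d := Set.mem_biUnion hx ha
      rw [hg.assoc] at h
      obtain ⟨y, hy, ha'⟩ := Set.mem_iUnion₂.1 h
      exact ⟨b, hb, y, ⟨c, hc, d, hd, hy⟩, ha'⟩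
    · rintro ⟨b, hb, y, ⟨c, hc, d, hd, hy⟩, ha⟩
      have h : a ∈ ⋃ y ∈ hg.hmul c d, hg.hmul b y := Set.mem_biUnion hy ha
      rw [← hg.assoc] at h
      obtain ⟨x, hx, ha'⟩ := Set.mem_iUnion₂.1 h
      exact ⟨x, ⟨b, hb, c, hc, hx⟩, d, hd, ha'⟩
  one_mul A := by
    change hg.smul {hg.e} A = A
    ext a
    simp [smul, hg.idl]
  mul_one A := by
    change hg.smul A {hg.e} = A
    ext a
    simp [smul, hg.idr]

theorem smul_singleton (hg : Hypergroup H) (p q : H) : hg.smul {p} {q} = hg.hmul p q := by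
  ext a
  simp [smul]

theorem smul_mono (hg : Hypergroup H) {A B C D : Set H} (h : A ⊆ C) (h' : B ⊆ D) :
    hg.smul A B ⊆ hg.smul C D := by
  rintro a ⟨b, hb, c, hc, ha⟩
  exact ⟨b, h hb, c, h' hc, ha⟩

theorem star_e (hg : Hypergroup H) : hg.star hg.e = hg.e := by
  have h := (hg.h3l hg.e hg.e hg.e).1 (by simp [hg.idl])
  rw [hg.idl] at h
  exact h.symm

theorem e_mem_star_mul_self (hg : Hypergroup H) (p : H) : hg.e ∈ hg.hmul (hg.star p) p :=
  (hg.h3r p p hg.e).1 (by simp [hg.idr])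

theorem star_mem_hmul (hg : Hypergroup H) {a b c : H} (h : a ∈ hg.hmul b c) :
    hg.star a ∈ hg.hmul (hg.star c) (hg.star b) :=
  (hg.h3l _ _ _).1 ((hg.h3r _ _ _).1 ((hg.h3l _ _ _).1 h))

theorem IsClosed.e_mem {hg : Hypergroup H} {G : Set H} (h : hg.IsClosed G) : hg.e ∈ G := by
  obtain ⟨⟨p, hp⟩, h⟩ := h
  exact h ⟨_, ⟨p, hp, rfl⟩, p, hp, hg.e_mem_star_mul_self p⟩

theorem isClosed_singleton_e (hg : Hypergroup H) : hg.IsClosed {hg.e} := by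
  refine ⟨⟨_, rfl⟩, ?_⟩
  rw [Set.image_singleton, hg.star_e, smul_singleton, hg.idl]

theorem IsInvolution.star_eq {hg : Hypergroup H} {q : H} (h : hg.IsInvolution q) :
    hg.star q = q := by
  obtain ⟨hne, -, hcl⟩ := h
  have hmem : hg.star q ∈ ({hg.e, q} : Set H) :=
    hcl ⟨hg.star q, ⟨q, by simp, rfl⟩, hg.e, by simp, by simp [hg.idr]⟩
  rcases hmem with h | h
  · have := hg.e_mem_star_mul_self q
    rw [h, hg.idl] at this
    exact absurd this.symm hne
  · exact h

theorem IsInvolution.hmul_self_subset {hg : Hypergroup H} {q : H} (h : hg.IsInvolution q) :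
    hg.hmul q q ⊆ {hg.e, q} := fun a ha =>
  h.2.2 ⟨q, ⟨q, by simp, h.star_eq⟩, q, by simp, ha⟩

theorem IsInvolution.gen_eq {hg : Hypergroup H} {q : H} (h : hg.IsInvolution q) :
    hg.gen {q} = {hg.e, q} := by
  refine Set.Subset.antisymm (Set.sInter_subset_of_mem ⟨h.2, by simp⟩) ?_
  rintro a (rfl | rfl) C ⟨hC, hq⟩
  · exact hC.e_mem
  · exact hq rfl

theorem listProd_eq_prod (hg : Hypergroup H) (l : List (Set H)) :
    hg.listProd l = (letI := hg.setMonoid; l.prod) := by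
  let := hg.setMonoid
  induction l with
  | nil => rfl
  | cons a l ih =>
    rw [List.prod_cons, ← ih]
    rfl

section Lists

variable {ι : Type*} (hg : Hypergroup H)

theorem listProd_map_mono {A B : ι → Set H} (h : ∀ i, A i ⊆ B i) (l : List ι) :
    hg.listProd (l.map A) ⊆ hg.listProd (l.map B) := by
  induction l with
  | nil => exact subset_rfl
  | cons i l ih => exact hg.smul_mono (h i) ih

theorem smul_listProd_comm {A : Set H} {B : ι → Set H}
    (h : ∀ i, hg.smul A (B i) = hg.smul (B i) A) (l : List ι) :
    hg.smul A (hg.listProd (l.map B)) = hg.smul (hg.listProd (l.map B)) A := by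
  let := hg.setMonoid
  rw [listProd_eq_prod]
  refine Commute.list_prod_right _ _ fun x hx => ?_
  obtain ⟨i, -, rfl⟩ := List.mem_map.1 hx
  exact h i

theorem listProd_mul_self {A : ι → Set H}
    (h : ∀ i j, hg.smul (A i) (A j) = hg.smul (A j) (A i)) (l : List ι) :
    hg.smul (hg.listProd (l.map A)) (hg.listProd (l.map A)) =
      hg.listProd (l.map fun i => hg.smul (A i) (A i)) := by
  let := hg.setMonoid
  induction l with
  | nil => exact one_mul (1 : Set H)
  | cons i l ih =>
    have hc : Commute (hg.listProd (l.map A)) (A i) :=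
      (hg.smul_listProd_comm (h i) l).symm
    change (A i * hg.listProd (l.map A)) * (A i * hg.listProd (l.map A)) =
      (A i * A i) * hg.listProd (l.map fun i => hg.smul (A i) (A i))
    rw [hc.mul_mul_mul_comm, ← ih]
    rfl

theorem star_mem_listProd {r : ι → H} (hs : ∀ i, hg.star (r i) = r i)
    (h : ∀ i j, hg.hmul (r i) (r j) = hg.hmul (r j) (r i)) (l : List ι) {a : H}
    (ha : a ∈ hg.listProd (l.map fun i => {r i})) :
    hg.star a ∈ hg.listProd (l.map fun i => {r i}) := by
  induction l generalizing a with
  | nil => rw [show a = hg.e from ha, star_e]; rfl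
  | cons i l ih =>
    obtain ⟨b, rfl, c, hc, ha⟩ := ha
    change _ ∈ hg.smul _ _
    rw [smul_listProd_comm hg (by simpa only [smul_singleton] using h i)]
    exact ⟨hg.star c, ih hc, r i, rfl, by simpa only [hs] using hg.star_mem_hmul ha⟩

theorem exists_mem_listProd_singleton {S : ι → Set H} (hS : ∀ i, (S i).Nonempty)
    {l : List ι} (hl : l.Nodup) {a : H} (ha : a ∈ hg.listProd (l.map S)) :
    ∃ s : ι → H, (∀ i, s i ∈ S i) ∧ a ∈ hg.listProd (l.map fun i => {s i}) := by
  classical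
  induction l generalizing a with
  | nil =>
    choose s h_mem using hS
    exact ⟨s, h_mem, ha⟩
  | cons i l ih =>
    obtain ⟨b, hb, c, hc, ha⟩ := ha
    obtain ⟨hi, hl⟩ := List.nodup_cons.1 hl
    obtain ⟨s, h_mem, hc⟩ := ih hl hc
    refine ⟨Function.update s i b, fun j => ?_, b, by simp, c, ?_, ha⟩
    · by_cases h : j = i
      · subst h; simpa
      · simpa [h] using h_mem j
    · rwa [List.map_congr_left fun j hj => ?_]
      rw [Function.update_of_ne (by rintro rfl; exact hi hj)]

end Lists

/-- Thin closed subsets are residually thin, in any hypergroup. -/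
theorem isResiduallyThin_of_thin (hg : Hypergroup H) {G : Set H} (hG : hg.IsClosed G)
    (h : ∀ p ∈ G, hg.IsThin p) : hg.IsResiduallyThin G := by
  by_cases hGe : G = {hg.e}
  · exact ⟨0, fun _ => G, fun i j _ => Subsingleton.elim (α := Fin 1) i j, hGe, rfl,
      fun i => i.elim0⟩
  · refine ⟨1, ![{hg.e}, G], ?_, rfl, rfl, fun i => ?_⟩
    · intro i j
      fin_cases i <;> fin_cases j <;> simp [hGe, Ne.symm hGe]
    · rw [Fin.fin_one_eq_zero i]
      refine ⟨hg.isClosed_singleton_e, hG, by simpa using hG.e_mem, fun p hp => ?_⟩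
      change hg.smul (hg.smul {hg.star p} {hg.e}) {p} ⊆ {hg.e}
      rw [smul_singleton, hg.idr, smul_singleton, h p hp]

/-- If every member of a set `p*p` lies in its own `a*a`, residually thin subsets are thin. -/
theorem IsResiduallyThin.isThin {hg : Hypergroup H} {G : Set H} (hG : hg.IsResiduallyThin G)
    (h : ∀ p, ∀ a ∈ hg.hmul (hg.star p) p, a ∈ hg.hmul (hg.star a) a) {p : H} (hp : p ∈ G) :
    hg.IsThin p := by
  obtain ⟨m, F, -, h0, hm, hF⟩ := hG
  have step (i : Fin m) {p a : H} (hp : p ∈ F i.succ) (ha : a ∈ hg.hmul (hg.star p) p) :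
      a ∈ F i.castSucc := by
    obtain ⟨hcl, -, -, hn⟩ := hF i
    exact hn p hp ⟨hg.star p, ⟨_, rfl, hg.e, hcl.e_mem, by simp [hg.idr]⟩, p, rfl, ha⟩
  have descend {a : H} (ha : a ∈ hg.hmul (hg.star a) a) (i : Fin (m + 1)) :
      a ∈ F i → a ∈ F 0 := by
    induction i using Fin.induction with
    | zero => exact id
    | succ i ih => exact fun hi => ih (step i hi ha)
  refine Set.Subset.antisymm (fun a ha => ?_) (by simpa using hg.e_mem_star_mul_self p)
  rw [← hm] at hp
  rw [← h0]
  cases m with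
  | zero =>
    rw [show Fin.last 0 = 0 from rfl, h0, Set.mem_singleton_iff] at hp
    subst hp
    rwa [hg.star_e, hg.idl, ← h0] at ha
  | succ m => exact descend (h p a ha) _ (step (Fin.last m) hp ha)

end HyperPaper.Hypergroup

namespace HyperPaper.EA2Data

variable {H : Type*} (E : EA2Data H)

theorem hmul_q_subset (i j : Fin E.n) :
    E.hg.hmul (E.q i) (E.q j) ⊆ E.hg.hmul (E.q j) (E.q i) := by
  intro x hx
  have hn := (E.dp.1 j).2.2.2 (E.q i) trivial
  dsimp only at hn
  rw [(E.invol j).gen_eq] at hn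
  have hx' : x ∈ E.hg.smul {E.q i} {E.hg.e, E.q j} := ⟨_, rfl, _, by simp, hx⟩
  rw [← hn] at hx'
  obtain ⟨b, rfl | rfl, c, rfl, hb⟩ := hx'
  · rw [E.hg.idl, Set.mem_singleton_iff] at hb
    rw [hb, E.hg.h3r, (E.invol i).star_eq] at hx
    rcases (E.invol i).hmul_self_subset hx with h | h
    · exact absurd h (E.invol j).1
    · rw [h, hb, E.hg.h3r, (E.invol i).star_eq]
      rwa [h] at hx
  · exact hb

theorem hmul_comm_of_mem {r s : H} {i j : Fin E.n} (hr : r ∈ E.hg.gen {E.q i})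
    (hs : s ∈ E.hg.gen {E.q j}) : E.hg.hmul r s = E.hg.hmul s r := by
  rw [(E.invol _).gen_eq] at hr hs
  rcases hr with rfl | rfl
  · rw [E.hg.idl, E.hg.idr]
  rcases hs with rfl | rfl
  · rw [E.hg.idl, E.hg.idr]
  exact (E.hmul_q_subset i j).antisymm (E.hmul_q_subset j i)

theorem star_eq_of_mem {r : H} {i : Fin E.n} (hr : r ∈ E.hg.gen {E.q i}) :
    E.hg.star r = r := by
  rw [(E.invol _).gen_eq] at hr
  rcases hr with rfl | rfl
  · exact E.hg.star_e
  · exact (E.invol i).star_eq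

theorem hmul_self_of_mem {r s : H} {i : Fin E.n} (hr : r ∈ E.hg.gen {E.q i})
    (hs : s ∈ E.hg.hmul r r) : s ∈ E.hg.gen {E.q i} ∧ s ∈ E.hg.hmul s s := by
  rw [(E.invol _).gen_eq] at hr ⊢
  rcases hr with rfl | rfl
  · rw [E.hg.idl, Set.mem_singleton_iff] at hs
    subst hs
    simp [E.hg.idl]
  · rcases (E.invol i).hmul_self_subset hs with rfl | rfl
    · simp [E.hg.idl]
    · exact ⟨by simp, hs⟩

theorem exists_isDecomp (x : H) : ∃ r, E.hg.IsDecomp (fun i => E.hg.gen {E.q i}) x r := by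
  obtain ⟨r, hr, -⟩ : x ∈ E.hg.dcover (fun i => E.hg.gen {E.q i}) x := by
    rw [E.constrained x]
    rfl
  exact ⟨r, hr⟩

theorem famProd_eq {x : H} {r : Fin E.n → H}
    (hr : E.hg.IsDecomp (fun i => E.hg.gen {E.q i}) x r) : E.hg.famProd r = {x} := by
  refine Set.Subset.antisymm (fun y hy => ?_) (by simpa using hr.2)
  rw [← E.constrained x]
  exact ⟨r, hr, hy⟩

theorem star_eq (x : H) : E.hg.star x = x := by
  obtain ⟨r, hr⟩ := E.exists_isDecomp x
  have h : E.hg.star x ∈ E.hg.famProd r :=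
    E.hg.star_mem_listProd (fun i => E.star_eq_of_mem (hr.1 i))
      (fun i j => E.hmul_comm_of_mem (hr.1 i) (hr.1 j)) _ hr.2
  rwa [E.famProd_eq hr] at h

theorem hmul_self_eq {x : H} {r : Fin E.n → H}
    (hr : E.hg.IsDecomp (fun i => E.hg.gen {E.q i}) x r) :
    E.hg.hmul x x =
      E.hg.listProd ((List.finRange E.n).map fun i => E.hg.hmul (r i) (r i)) := by
  rw [← E.hg.smul_singleton, ← E.famProd_eq hr]
  simp only [← E.hg.smul_singleton (r _)]
  refine E.hg.listProd_mul_self (fun i j => ?_) _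
  simpa only [Hypergroup.smul_singleton] using E.hmul_comm_of_mem (hr.1 i) (hr.1 j)

theorem mem_star_mul_self {p a : H} (ha : a ∈ E.hg.hmul (E.hg.star p) p) :
    a ∈ E.hg.hmul (E.hg.star a) a := by
  rw [E.star_eq] at ha ⊢
  obtain ⟨r, hr⟩ := E.exists_isDecomp p
  rw [E.hmul_self_eq hr] at ha
  obtain ⟨s, hs, ha⟩ := E.hg.exists_mem_listProd_singleton
    (fun i => ⟨E.hg.e, by simpa only [E.star_eq] using E.hg.e_mem_star_mul_self (r i)⟩)
    (List.nodup_finRange _) ha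
  have hs' i := E.hmul_self_of_mem (hr.1 i) (hs i)
  rw [E.hmul_self_eq ⟨fun i => (hs' i).1, ha⟩]
  exact E.hg.listProd_map_mono (fun i => Set.singleton_subset_iff.2 (hs' i).2) _ ha

theorem isResiduallyThin_iff {G : Set H} (hG : E.hg.IsClosed G) :
    E.hg.IsResiduallyThin G ↔ G = E.hg.Othin G := by
  constructor
  · intro h
    exact Set.Subset.antisymm
      (fun p hp => ⟨hp, h.isThin (fun _ _ => E.mem_star_mul_self) hp⟩) fun p hp => hp.1
  · intro h
    refine E.hg.isResiduallyThin_of_thin hG fun p hp => ?_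
    rw [h] at hp
    exact hp.2

end HyperPaper.EA2Data

/-- A closed subset G of an elementary abelian 2-hypergroup H is
residually thin iff G = O_ϑ(G); in particular H is residually thin iff H = O_ϑ(H). -/
theorem stmt13 {H : Type*} (E : EA2Data H) (G : Set H) (hG : E.hg.IsClosed G) :
    (E.hg.IsResiduallyThin G ↔ G = E.hg.Othin G) ∧
    (E.hg.IsResiduallyThin (Set.univ : Set H) ↔
      (Set.univ : Set H) = E.hg.Othin Set.univ) := by
  exact ⟨E.isResiduallyThin_iff hG,
    E.isResiduallyThin_iff ⟨⟨E.hg.e, trivial⟩, Set.subset_univ _⟩⟩
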